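/- For all φ ∈ 𝒮(ℝ), all t with |t| ≥ 1, and all 0 < β < 1/4, ‖e^{it∂ₓₓ}φ‖_{L^∞(ℝ)} ≲ |t|^{-1/2} ‖φ̂‖_{L^∞} + |t|^{-1/2-β} ‖φ̂‖_{H^{1,0}}, where ‖ψ‖_{H^{1,0}} = ‖ψ‖_{L²} + ‖∂_ξ ψ‖_{L²} and the implicit constant depends only on β. -/

import Mathlib

open MeasureTheory Real

/-- Fourier transform with convention `φ̂(ξ) = (2π)^{-1/2} ∫ e^{-ixξ} φ(x) dx`. -/
noncomputable def ft (φ : ℝ → ℂ) (ξ : ℝ) : ℂ :=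
  (1 / Real.sqrt (2 * π) : ℝ) * ∫ x : ℝ, Complex.exp (-(Complex.I) * x * ξ) * φ x

/-- The free Schrödinger evolution `e^{it∂ₓₓ}φ = K_t * φ`,
with `K_t(x) = (4iπt)^{-1/2} e^{-x²/(4it)}`. -/
noncomputable def schrod (t : ℝ) (φ : ℝ → ℂ) (x : ℝ) : ℂ :=
  ∫ y : ℝ, (4 * (π : ℂ) * Complex.I * t) ^ (-(1 / 2) : ℂ) *
    Complex.exp (Complex.I * ((x : ℂ) - y) ^ 2 / (4 * t)) * φ y

open scoped FourierTransform

lemma ft_eq_fourier (φ : ℝ → ℂ) (ξ : ℝ) :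
    ft φ ξ = (1 / Real.sqrt (2 * π) : ℝ) * 𝓕 φ ((2 * π)⁻¹ * ξ) := by
  unfold ft
  rw [Real.fourier_real_eq_integral_exp_smul]
  congr 2
  ext x
  rw [smul_eq_mul]
  congr 2
  push_cast
  have : (π : ℂ) ≠ 0 := by exact_mod_cast Real.pi_ne_zero
  field_simp

/-- The Fourier transform `ft` of a Schwartz function is again a Schwartz function. -/
lemma exists_schwartzMap_eq_ft (φ : SchwartzMap ℝ ℂ) :
    ∃ g : SchwartzMap ℝ ℂ, ft (fun y => φ y) = g := by
  have h : (2 * π)⁻¹ ≠ 0 := by positivity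
  refine ⟨((1 / Real.sqrt (2 * π) : ℝ) : ℂ) • SchwartzMap.compCLMOfContinuousLinearEquiv ℂ
    (ContinuousLinearEquiv.unitsEquivAut ℝ (Units.mk0 _ h)) (𝓕 φ), ?_⟩
  ext ξ
  rw [ft_eq_fourier]
  simp [SchwartzMap.fourier_coe, mul_comm]

lemma SchwartzMap.toReal_eLpNorm_two (g : SchwartzMap ℝ ℂ) :
    (eLpNorm g 2 volume).toReal = (∫ x, ‖g x‖ ^ 2) ^ (1 / 2 : ℝ) := by
  rw [MemLp.eLpNorm_eq_integral_rpow_norm two_ne_zero ENNReal.ofNat_ne_top (g.memLp 2 volume),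
    ENNReal.toReal_ofReal (by positivity)]
  simp

/-- Plancherel's theorem for `ft`. -/
lemma toReal_eLpNorm_ft (φ : SchwartzMap ℝ ℂ) :
    (eLpNorm (ft fun y => φ y) 2 volume).toReal = (eLpNorm φ 2 volume).toReal := by
  obtain ⟨g, hg⟩ := exists_schwartzMap_eq_ft φ
  rw [hg, SchwartzMap.toReal_eLpNorm_two, SchwartzMap.toReal_eLpNorm_two, ← hg]
  congr 1
  have hpt : ∀ ξ, ‖ft (fun y => φ y) ξ‖ ^ 2 = (2 * π)⁻¹ * ‖(𝓕 φ) ((2 * π)⁻¹ * ξ)‖ ^ 2 := by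
    intro ξ
    rw [ft_eq_fourier, norm_mul, mul_pow, Complex.norm_real, Real.norm_eq_abs, sq_abs, div_pow,
      Real.sq_sqrt (by positivity), SchwartzMap.fourier_coe]
    simp
  simp_rw [hpt]
  have hscale := Measure.integral_comp_mul_left (fun ξ => ‖(𝓕 φ) ξ‖ ^ 2) (2 * π)⁻¹
  rw [integral_const_mul, hscale, SchwartzMap.integral_norm_sq_fourier, inv_inv, abs_of_pos (by positivity), smul_eq_mul,
    inv_mul_cancel_left₀ (by positivity)]

/-- Differentiating `ft φ` amounts to multiplying `φ` by `-ix`. -/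
lemma exists_schwartzMap_deriv_ft (φ : SchwartzMap ℝ ℂ) :
    ∃ ψ : SchwartzMap ℝ ℂ, (∀ x, ‖ψ x‖ = |x| * ‖φ x‖) ∧
      deriv (ft fun y => φ y) = ft fun y => ψ y := by
  have hgrowth : Function.HasTemperateGrowth fun x : ℝ => -Complex.I * (x : ℂ) := by fun_prop
  have hψ := SchwartzMap.smulLeftCLM_apply_apply hgrowth φ
  set ψ := SchwartzMap.smulLeftCLM ℂ (fun x : ℝ => -Complex.I * (x : ℂ)) φ
  refine ⟨ψ, fun x => by simp [hψ], ?_⟩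
  have hint : Integrable fun x : ℝ => x • φ x := by
    have := (ψ.integrable (μ := volume)).const_mul Complex.I
    refine this.congr (.of_forall fun x => ?_)
    simp only [hψ, smul_eq_mul, Complex.real_smul]
    linear_combination (-(x : ℂ) * φ x) * Complex.I_mul_I
  ext ξ
  rw [funext (ft_eq_fourier fun y => φ y), ft_eq_fourier]
  have hd := (Real.hasDerivAt_fourier (φ.integrable (μ := volume)) hint ((2 * π)⁻¹ * ξ)).scomp ξ
    ((hasDerivAt_id ξ).const_mul (2 * π)⁻¹)
  have hd' := (hd.const_mul ((1 / Real.sqrt (2 * π) : ℝ) : ℂ)).deriv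
  refine hd'.trans ?_
  congr 1
  have hfun : (fun x : ℝ => (-2 * (π : ℂ) * Complex.I * x) • φ x)
      = ⇑(((2 * π : ℝ) : ℂ) • ψ) := by
    ext x
    simp only [smul_apply, hψ, smul_eq_mul]
    push_cast
    ring
  rw [hfun, ← SchwartzMap.fourier_coe, ← SchwartzMap.fourier_coe, FourierTransform.fourier_smul,
    smul_apply, Complex.real_smul, smul_eq_mul]
  have : (π : ℂ) ≠ 0 := by exact_mod_cast Real.pi_ne_zero
  push_cast
  field_simp

/-- A continuous essentially bounded function is bounded pointwise by its `L^∞` norm. -/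
lemma norm_le_toReal_eLpNorm_top {f : ℝ → ℂ} (hf : Continuous f)
    (hf' : MemLp f ⊤ (volume : Measure ℝ)) (x : ℝ) :
    ‖f x‖ ≤ (eLpNorm f ⊤ (volume : Measure ℝ)).toReal := by
  have hae : ∀ᵐ y, ‖f y‖ ≤ (eLpNorm f ⊤ (volume : Measure ℝ)).toReal := by
    filter_upwards [ae_le_eLpNormEssSup (f := f) (μ := volume)] with y hy
    rw [eLpNorm_exponent_top, ← toReal_enorm]
    exact ENNReal.toReal_mono (by simpa using hf'.eLpNorm_ne_top) hy
  have hclosed : IsClosed {y | ‖f y‖ ≤ (eLpNorm f ⊤ (volume : Measure ℝ)).toReal} :=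
    isClosed_le hf.norm continuous_const
  have huniv := (Measure.dense_of_ae hae).closure_eq
  rw [hclosed.closure_eq] at huniv
  exact Set.eq_univ_iff_forall.mp huniv x

lemma norm_ft_le (φ : SchwartzMap ℝ ℂ) (ξ : ℝ) :
    ‖ft (fun y => φ y) ξ‖ ≤ (eLpNorm (ft fun y => φ y) ⊤ (volume : Measure ℝ)).toReal := by
  obtain ⟨g, hg⟩ := exists_schwartzMap_eq_ft φ
  rw [hg]
  exact norm_le_toReal_eLpNorm_top g.continuous (g.memLp ⊤) ξ

/-- Interpolation between the trivial and the Lipschitz bound for `e^{iθ} - 1`. -/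
lemma norm_exp_I_mul_sub_one_le_rpow {β : ℝ} (hβ0 : 0 ≤ β) (hβ1 : β ≤ 1) (θ : ℝ) :
    ‖Complex.exp (Complex.I * θ) - 1‖ ≤ 2 * |θ| ^ β := by
  rcases le_total |θ| 1 with h | h
  · calc _ ≤ |θ| := Real.norm_exp_I_mul_ofReal_sub_one_le
      _ = |θ| ^ (1 : ℝ) := (Real.rpow_one _).symm
      _ ≤ |θ| ^ β := Real.rpow_le_rpow_of_exponent_ge' (abs_nonneg _) h hβ0 hβ1
      _ ≤ 2 * |θ| ^ β := by linarith [Real.rpow_nonneg (abs_nonneg θ) β]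
  · have h1 : ‖Complex.exp (Complex.I * θ) - 1‖ ≤ 2 := by
      rw [Complex.norm_exp_I_mul_ofReal_sub_one, norm_mul, Real.norm_two, Real.norm_eq_abs]
      linarith [Real.abs_sin_le_one (θ / 2)]
    linarith [Real.one_le_rpow h hβ0]

lemma memLp_two_one_add_abs_rpow {s : ℝ} (hs : 1 / 2 < s) :
    MemLp (fun y : ℝ => (1 + |y|) ^ (-s)) 2 := by
  have hcont : Continuous fun y : ℝ => (1 + |y|) ^ (-s) :=
    (by fun_prop : Continuous fun y : ℝ => 1 + |y|).rpow_const fun y => .inl (by positivity)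
  rw [memLp_two_iff_integrable_sq hcont.aestronglyMeasurable]
  have hint := integrable_one_add_norm (E := ℝ) (μ := volume) (r := 2 * s)
    (by simp only [Module.finrank_self, Nat.cast_one]; linarith)
  refine hint.congr (.of_forall fun y => ?_)
  simp only [Real.norm_eq_abs]
  rw [← Real.rpow_mul_natCast (by positivity)]
  congr 1
  push_cast
  ring

lemma integral_mul_norm_le {f : ℝ → ℝ} (hf0 : ∀ y, 0 ≤ f y) (hf : MemLp f 2)
    (φ : SchwartzMap ℝ ℂ) :
    Integrable (fun y => f y * ‖φ y‖) ∧
      ∫ y, f y * ‖φ y‖ ≤ (∫ y, f y ^ 2) ^ (1 / 2 : ℝ) * (eLpNorm φ 2 volume).toReal := by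
  refine ⟨hf.integrable_mul (φ.memLp 2).norm, ?_⟩
  have := integral_mul_le_Lp_mul_Lq_of_nonneg (μ := volume) Real.HolderConjugate.two_two
    (f := f) (g := fun y => ‖φ y‖) (.of_forall hf0) (.of_forall fun y => norm_nonneg _)
    (by simpa using hf) (by simpa using (φ.memLp 2).norm)
  rw [SchwartzMap.toReal_eLpNorm_two]
  simpa using this

/-- `|y|^{2β} φ` is integrable, with a bound by the weighted `L²` norm of `φ`. -/
lemma exists_integral_rpow_mul_norm_le {β : ℝ} (hβ0 : 0 < β) (hβ1 : β < 1 / 4) :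
    ∃ K : ℝ, 0 ≤ K ∧ ∀ φ ψ : SchwartzMap ℝ ℂ, (∀ y, ‖ψ y‖ = |y| * ‖φ y‖) →
      Integrable (fun y => |y| ^ (2 * β) * ‖φ y‖) ∧
      ∫ y, |y| ^ (2 * β) * ‖φ y‖ ≤
        K * ((eLpNorm φ 2 volume).toReal + (eLpNorm ψ 2 volume).toReal) := by
  set f : ℝ → ℝ := fun y => (1 + |y|) ^ (-(1 - 2 * β)) with hfdef
  have hf0 : ∀ y, 0 ≤ f y := fun y => by positivity
  have hf : MemLp f 2 := memLp_two_one_add_abs_rpow (by linarith)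
  refine ⟨(∫ y, f y ^ 2) ^ (1 / 2 : ℝ),
    Real.rpow_nonneg (integral_nonneg fun y => sq_nonneg _) _, fun φ ψ hψ => ?_⟩
  obtain ⟨hφi, hφ⟩ := integral_mul_norm_le hf0 hf φ
  obtain ⟨hψi, hψ'⟩ := integral_mul_norm_le hf0 hf ψ
  have hle : ∀ y, |y| ^ (2 * β) * ‖φ y‖ ≤ f y * ‖φ y‖ + f y * ‖ψ y‖ := by
    intro y
    have hy : (0 : ℝ) < 1 + |y| := by positivity
    have hfy : f y * (1 + |y|) = (1 + |y|) ^ (2 * β) := by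
      rw [← Real.rpow_add_one hy.ne']
      congr 1
      ring
    have hmono : |y| ^ (2 * β) ≤ (1 + |y|) ^ (2 * β) :=
      Real.rpow_le_rpow (abs_nonneg y) (by linarith) (by linarith)
    calc |y| ^ (2 * β) * ‖φ y‖ ≤ f y * (1 + |y|) * ‖φ y‖ := by rw [hfy]; gcongr
      _ = _ := by rw [hψ]; ring
  have hcont : Continuous fun y => |y| ^ (2 * β) * ‖φ y‖ :=
    ((continuous_abs.rpow_const fun y => .inr (by linarith)).mul φ.continuous.norm)
  have hint : Integrable fun y => |y| ^ (2 * β) * ‖φ y‖ := by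
    refine (hφi.add hψi).mono' hcont.aestronglyMeasurable (.of_forall fun y => ?_)
    rw [Real.norm_of_nonneg (by positivity)]
    exact hle y
  refine ⟨hint, ?_⟩
  calc _ ≤ ∫ y, (f y * ‖φ y‖ + f y * ‖ψ y‖) := integral_mono hint (hφi.add hψi) hle
    _ = (∫ y, f y * ‖φ y‖) + ∫ y, f y * ‖ψ y‖ := integral_add hφi hψi
    _ ≤ _ := by linarith

/-- The evolution factors as modulation, multiplication by a quadratic phase and Fourier
transform. -/
lemma norm_schrod_eq {t : ℝ} (ht : t ≠ 0) (φ : ℝ → ℂ) (x : ℝ) :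
    ‖schrod t φ x‖ = (4 * π * |t|) ^ (-(1 / 2) : ℝ) *
      ‖∫ y : ℝ, Complex.exp (-Complex.I * y * (x / (2 * t) : ℝ)) *
        (Complex.exp (Complex.I * (y ^ 2 / (4 * t) : ℝ)) * φ y)‖ := by
  have htc : (t : ℂ) ≠ 0 := by exact_mod_cast ht
  have hpi : (π : ℂ) ≠ 0 := by exact_mod_cast Real.pi_ne_zero
  have hfac : schrod t φ x = ((4 * (π : ℂ) * Complex.I * t) ^ (-(1 / 2) : ℂ) *
      Complex.exp ((x ^ 2 / (4 * t) : ℝ) * Complex.I)) *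
      ∫ y : ℝ, Complex.exp (-Complex.I * y * (x / (2 * t) : ℝ)) *
        (Complex.exp (Complex.I * (y ^ 2 / (4 * t) : ℝ)) * φ y) := by
    unfold schrod
    rw [← integral_const_mul]
    congr 1
    ext y
    have hphase : Complex.exp (Complex.I * ((x : ℂ) - y) ^ 2 / (4 * t)) =
        Complex.exp ((x ^ 2 / (4 * t) : ℝ) * Complex.I) *
          (Complex.exp (-Complex.I * y * (x / (2 * t) : ℝ)) *
            Complex.exp (Complex.I * (y ^ 2 / (4 * t) : ℝ))) := by
      rw [← Complex.exp_add, ← Complex.exp_add]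
      congr 1
      push_cast
      field_simp
      ring
    rw [hphase]
    ring
  have hre : (-(1 / 2) : ℂ).re = -(1 / 2) := by norm_num
  have him : (-(1 / 2) : ℂ).im = 0 := by norm_num
  rw [hfac, norm_mul, norm_mul, Complex.norm_exp_ofReal_mul_I, mul_one,
    Complex.norm_cpow_of_ne_zero (by simp [htc, hpi]), hre, him]
  simp [abs_of_pos Real.pi_pos]

theorem stmt_6 (β : ℝ) (hβ0 : 0 < β) (hβ1 : β < 1 / 4) :
    ∃ C : ℝ, 0 < C ∧ ∀ (φ : SchwartzMap ℝ ℂ) (t : ℝ), 1 ≤ |t| → ∀ x : ℝ,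
      ‖schrod t (fun y => φ y) x‖ ≤
        C * (|t| ^ (-(1 / 2) : ℝ) * (eLpNorm (ft fun y => φ y) ⊤ (volume : Measure ℝ)).toReal +
          |t| ^ (-(1 / 2) - β) *
            ((eLpNorm (ft fun y => φ y) 2 volume).toReal +
              (eLpNorm (deriv (ft fun y => φ y)) 2 volume).toReal)) := by
  obtain ⟨K, hK0, hK⟩ := exists_integral_rpow_mul_norm_le hβ0 hβ1
  refine ⟨Real.sqrt (2 * π) + 2 * K, by positivity, fun φ t ht x => ?_⟩
  obtain ⟨ψ, hψ, hderiv⟩ := exists_schwartzMap_deriv_ft φ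
  rw [hderiv, toReal_eLpNorm_ft, toReal_eLpNorm_ft]
  obtain ⟨hint, hbound⟩ := hK φ ψ hψ
  have htpos : 0 < |t| := by linarith
  have ht0 : t ≠ 0 := abs_pos.mp htpos
  set M := (eLpNorm (ft fun y => φ y) ⊤ (volume : Measure ℝ)).toReal
  set N := (eLpNorm φ 2 volume).toReal + (eLpNorm ψ 2 volume).toReal
  have hM : 0 ≤ M := ENNReal.toReal_nonneg
  have hN : 0 ≤ N := add_nonneg ENNReal.toReal_nonneg ENNReal.toReal_nonneg
  set ξ : ℝ := x / (2 * t)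
  set e : ℝ → ℂ := fun y => Complex.exp (-Complex.I * y * ξ) with he
  set q : ℝ → ℂ := fun y => Complex.exp (Complex.I * (y ^ 2 / (4 * t) : ℝ)) with hq
  have he1 : ∀ y, ‖e y‖ = 1 := fun y => by simp [he, Complex.norm_exp]
  have hec : Continuous e := by fun_prop
  have hqc : Continuous q := by fun_prop
  have hpt : ∀ y, ‖e y * ((q y - 1) * φ y)‖ ≤ 2 * |t| ^ (-β) * (|y| ^ (2 * β) * ‖φ y‖) := by
    intro y
    rw [norm_mul, he1, one_mul, norm_mul, ← mul_assoc]
    refine mul_le_mul_of_nonneg_right ?_ (norm_nonneg _)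
    refine (norm_exp_I_mul_sub_one_le_rpow hβ0.le (by linarith) _).trans ?_
    have h1 : |y ^ 2 / (4 * t)| ≤ |y| ^ 2 * |t|⁻¹ := by
      rw [abs_div, abs_mul, abs_pow, div_eq_mul_inv, abs_of_pos (by norm_num : (0 : ℝ) < 4)]
      gcongr
      linarith
    have h2 : |y ^ 2 / (4 * t)| ^ β ≤ (|y| ^ 2 * |t|⁻¹) ^ β :=
      Real.rpow_le_rpow (abs_nonneg _) h1 hβ0.le
    rw [Real.mul_rpow (by positivity) (by positivity), Real.inv_rpow htpos.le,
      ← Real.rpow_neg htpos.le, ← Real.rpow_natCast_mul (abs_nonneg y)] at h2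
    push_cast at h2
    linarith
  have hint1 : Integrable fun y => e y * φ y :=
    φ.integrable.bdd_mul hec.aestronglyMeasurable (.of_forall fun y => (he1 y).le)
  have hint2 : Integrable fun y => e y * ((q y - 1) * φ y) :=
    (hint.const_mul (2 * |t| ^ (-β))).mono'
      (hec.mul ((hqc.sub continuous_const).mul φ.continuous)).aestronglyMeasurable
      (.of_forall hpt)
  have hsplit : (∫ y, e y * (q y * φ y)) =
      (∫ y, e y * φ y) + ∫ y, e y * ((q y - 1) * φ y) := by
    rw [← integral_add hint1 hint2]
    congr 1
    ext y
    ring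
  have hmain : ‖∫ y, e y * φ y‖ ≤ Real.sqrt (2 * π) * M := by
    have hft : ‖∫ y, e y * φ y‖ = Real.sqrt (2 * π) * ‖ft (fun y => φ y) ξ‖ := by
      unfold ft
      rw [norm_mul, Complex.norm_real, Real.norm_of_nonneg (by positivity), ← mul_assoc,
        mul_one_div_cancel (by positivity), one_mul]
    rw [hft]
    gcongr
    exact norm_ft_le φ ξ
  have herr : ‖∫ y, e y * ((q y - 1) * φ y)‖ ≤ 2 * |t| ^ (-β) * (K * N) := by
    refine (norm_integral_le_of_norm_le (hint.const_mul _) (.of_forall hpt)).trans ?_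
    rw [integral_const_mul]
    gcongr
  have hpre : (4 * π * |t|) ^ (-(1 / 2) : ℝ) ≤ |t| ^ (-(1 / 2) : ℝ) :=
    Real.rpow_le_rpow_of_nonpos htpos
      (le_mul_of_one_le_left htpos.le (by nlinarith [Real.pi_gt_three])) (by norm_num)
  rw [norm_schrod_eq ht0]
  calc _ ≤ |t| ^ (-(1 / 2) : ℝ) * (Real.sqrt (2 * π) * M + 2 * |t| ^ (-β) * (K * N)) := by
        refine mul_le_mul hpre ?_ (norm_nonneg _) (by positivity)
        exact hsplit ▸ (norm_add_le _ _).trans (add_le_add hmain herr)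
    _ = Real.sqrt (2 * π) * (|t| ^ (-(1 / 2) : ℝ) * M) +
        2 * K * (|t| ^ (-(1 / 2) - β) * N) := by
        rw [sub_eq_add_neg, Real.rpow_add htpos]
        ring
    _ ≤ _ := by
        have h1 : 0 ≤ |t| ^ (-(1 / 2) : ℝ) * M := by positivity
        have h2 : 0 ≤ |t| ^ (-(1 / 2) - β) * N := by positivity
        nlinarith [mul_nonneg hK0 h1, mul_nonneg (Real.sqrt_nonneg (2 * π)) h2]
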